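/- arXiv:2207.01027 — 2 statements merged into one kernel-verified Lean document; each statement's English description precedes it below -/
import Mathlib

section
/- Let q be a prime power, let N, k, m, h be integers with 1 ≤ k ≤ N, 1 ≤ m ≤ N−k and 1 ≤ h ≤ m−1, and let A be a partial m-spread of F_q^N. Then the number of k-dimensional (A,h)-scattered F_q-subspaces of F_q^N is at least [N choose k]_q − |A|·∂_q(N,k,m,h), where ∂_q(N,k,m,h) = Σ_{ℓ=h+1}^{m} Σ_{b=ℓ}^{m} [m choose ℓ]_q [m−ℓ choose b−ℓ]_q [N−b choose k−b]_q (−1)^{b−ℓ} q^{(b−ℓ)(b−ℓ−1)/2}. -/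
/-- The Gaussian binomial coefficient `[a choose b]_q`, defined via the `q`-Pascal
recursion; it equals the number of `b`-dimensional `F_q`-subspaces of `F_q^a`. -/
def gaussBinomNat (q : ℕ) : ℕ → ℕ → ℕ
  | _, 0 => 1
  | 0, _ + 1 => 0
  | a + 1, b + 1 => gaussBinomNat q a b + q ^ (b + 1) * gaussBinomNat q a (b + 1)

/-- The Gaussian binomial coefficient with integer indices, with the convention that it
vanishes when `b < 0` or `b > a`. -/
def gaussBinom (q : ℕ) (a b : ℤ) : ℤ :=
  if 0 ≤ b ∧ b ≤ a then gaussBinomNat q a.toNat b.toNat else 0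

/-- The quantity `∂_q(N,k,m,h)`. -/
def partialDelta (q N k m h : ℕ) : ℤ :=
  ∑ l ∈ Finset.Icc (h + 1) m, ∑ b ∈ Finset.Icc l m,
    gaussBinom q m l * gaussBinom q ((m : ℤ) - l) ((b : ℤ) - l) *
      gaussBinom q ((N : ℤ) - b) ((k : ℤ) - b) * (-1) ^ (b - l) *
      (q : ℤ) ^ ((b - l) * (b - l - 1) / 2)

section

open Finset Module

lemma gaussBinomNat_eq_zero_of_lt (q : ℕ) : ∀ {n k : ℕ}, n < k → gaussBinomNat q n k = 0
  | _, 0, h => absurd h (Nat.not_lt_zero _)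
  | 0, _ + 1, _ => rfl
  | n + 1, k + 1, h => by
    rw [gaussBinomNat, gaussBinomNat_eq_zero_of_lt q (by omega : n < k),
      gaussBinomNat_eq_zero_of_lt q (by omega : n < k + 1), mul_zero, add_zero]

@[simp] lemma gaussBinomNat_zero_right (q n : ℕ) : gaussBinomNat q n 0 = 1 := by
  cases n <;> rfl

lemma gaussBinom_natCast (q n k : ℕ) : gaussBinom q n k = gaussBinomNat q n k := by
  unfold gaussBinom
  split_ifs with h
  · simp
  · rw [gaussBinomNat_eq_zero_of_lt q (by omega), Nat.cast_zero]

lemma prod_pow_sub_pow_succ (q : ℤ) (n k : ℕ) :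
    ∏ i ∈ range (k + 1), (q ^ (n + 1) - q ^ i) =
      (q ^ (n + 1) - 1) * q ^ k * ∏ i ∈ range k, (q ^ n - q ^ i) := by
  have h : ∀ i ∈ range k, q ^ (n + 1) - q ^ (i + 1) = q * (q ^ n - q ^ i) := fun i _ => by ring
  rw [prod_range_succ', prod_congr rfl h, prod_mul_distrib, prod_const, card_range]
  ring

lemma gaussBinomNat_mul_prod (q n k : ℕ) :
    (gaussBinomNat q n k : ℤ) * ∏ i ∈ range k, ((q : ℤ) ^ k - (q : ℤ) ^ i) =
      ∏ i ∈ range k, ((q : ℤ) ^ n - (q : ℤ) ^ i) := by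
  induction n generalizing k with
  | zero =>
    cases k with
    | zero => simp
    | succ k => simp [gaussBinomNat, prod_range_succ']
  | succ n ih =>
    cases k with
    | zero => simp
    | succ k =>
      have h₁ := ih k
      have h₂ := ih (k + 1)
      rw [gaussBinomNat, prod_pow_sub_pow_succ (q : ℤ) n k, ← h₁]
      rw [prod_range_succ (fun i => (q : ℤ) ^ n - (q : ℤ) ^ i), ← h₁] at h₂
      rw [prod_pow_sub_pow_succ (q : ℤ) k k] at h₂ ⊢
      push_cast
      linear_combination (q : ℤ) ^ (k + 1) * h₂

lemma sum_neg_one_pow_mul_gaussBinomNat (q : ℕ) {n M : ℕ} (hM : n < M) :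
    ∑ j ∈ range M, (gaussBinomNat q n j : ℤ) * (-1) ^ j * (q : ℤ) ^ (j * (j - 1) / 2) =
      if n = 0 then 1 else 0 := by
  obtain ⟨M, rfl⟩ : ∃ M', M = M' + 1 := ⟨M - 1, by omega⟩
  rw [sum_range_succ']
  cases n with
  | zero => simp [gaussBinomNat]
  | succ n =>
    let u : ℕ → ℤ := fun j => (-1) ^ j * (q : ℤ) ^ ((j + 1) * j / 2) * gaussBinomNat q n j
    have h : ∀ j ∈ range M, (gaussBinomNat q (n + 1) (j + 1) : ℤ) * (-1) ^ (j + 1) *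
        (q : ℤ) ^ ((j + 1) * (j + 1 - 1) / 2) = u (j + 1) - u j := fun j _ => by
      have e : (j + 1 + 1) * (j + 1) / 2 = (j + 1) * j / 2 + (j + 1) := by
        rw [← Nat.add_mul_div_right _ _ two_pos]; congr 1; ring
      simp only [u, gaussBinomNat, e, Nat.add_sub_cancel]
      push_cast
      ring
    rw [sum_congr rfl h, sum_range_sub]
    simp [u, gaussBinomNat_eq_zero_of_lt q (by omega : n < M)]

section Counting

variable {F : Type*} [Field F] [Fintype F]
  {V : Type*} [AddCommGroup V] [Module F V] [Finite V]

/-- Linearly independent `k`-tuples, sorted by the `k`-dimensional subspace they span. -/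
noncomputable def linearIndependentEquivSigma (k : ℕ) :
    {s : Fin k → V // LinearIndependent F s} ≃
      Σ W : {W : Submodule F V // finrank F W = k},
        {s : Fin k → W.1 // LinearIndependent F s} where
  toFun s := ⟨⟨Submodule.span F (Set.range s.1), by
      simpa using finrank_span_eq_card s.2⟩,
    ⟨fun i => ⟨s.1 i, Submodule.subset_span ⟨i, rfl⟩⟩, by
      exact LinearIndependent.of_comp (Submodule.subtype _) s.2⟩⟩
  invFun p := ⟨fun i => (p.2.1 i : V), p.2.2.map' (Submodule.subtype _) (by simp)⟩
  left_inv _ := rfl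
  right_inv := by
    rintro ⟨⟨W, hW⟩, ⟨s, hs⟩⟩
    have : Submodule.span F (Set.range fun i => (s i : V)) = W := by
      have h := hs.span_eq_top_of_card_eq_finrank' (by simpa using hW.symm)
      have := congrArg (Submodule.map W.subtype) h
      rwa [Submodule.map_span, ← Set.range_comp, Submodule.map_top, Submodule.range_subtype]
        at this
    have transport : ∀ W' : Submodule F V, W' = W → ∀ (hW' : finrank F W' = k)
        (hmem : ∀ i, (s i : V) ∈ W')
        (hli : LinearIndependent F fun i => (⟨s i, hmem i⟩ : W')),
        (⟨⟨W', hW'⟩, ⟨fun i => ⟨s i, hmem i⟩, hli⟩⟩ :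
          Σ W : {W : Submodule F V // finrank F W = k},
            {s : Fin k → W.1 // LinearIndependent F s}) = ⟨⟨W, hW⟩, ⟨s, hs⟩⟩ := by
      rintro _ rfl _ _ _
      rfl
    exact transport _ this _ _ _

lemma natCard_submodule_finrank_eq (k : ℕ) :
    Nat.card {W : Submodule F V // finrank F W = k} =
      gaussBinomNat (Fintype.card F) (finrank F V) k := by
  classical
  have := Fintype.ofFinite V
  by_cases hk : k ≤ finrank F V
  swap
  · rw [gaussBinomNat_eq_zero_of_lt _ (not_le.mp hk), Nat.card_eq_zero]
    exact Or.inl ⟨fun W => hk (W.2 ▸ Submodule.finrank_le W.1)⟩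
  have := Fintype.ofFinite (Submodule F V)
  have hq : 1 < Fintype.card F := Fintype.one_lt_card
  have cast_prod : ∀ n, k ≤ n → ((∏ i : Fin k,
      (Fintype.card F ^ n - Fintype.card F ^ i.val) : ℕ) : ℤ) =
      ∏ i ∈ range k, ((Fintype.card F : ℤ) ^ n - (Fintype.card F : ℤ) ^ i) := fun n hn => by
    rw [← Fin.prod_univ_eq_prod_range (fun i => (Fintype.card F : ℤ) ^ n - (Fintype.card F : ℤ) ^ i),
      Nat.cast_prod]
    refine prod_congr rfl fun i _ => ?_
    rw [Nat.cast_sub (Nat.pow_le_pow_right hq.le (by omega))]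
    push_cast
    rfl
  have h := Nat.card_congr (linearIndependentEquivSigma (F := F) (V := V) k)
  rw [card_linearIndependent hk, Nat.card_sigma] at h
  have hW : ∀ W : {W : Submodule F V // finrank F W = k},
      Nat.card {s : Fin k → W.1 // LinearIndependent F s} =
        ∏ i : Fin k, (Fintype.card F ^ k - Fintype.card F ^ i.val) := fun W => by
    rw [card_linearIndependent W.2.ge, W.2]
  rw [sum_congr rfl fun W _ => hW W, sum_const, card_univ, smul_eq_mul] at h
  have hz := congrArg (Nat.cast (R := ℤ)) h
  rw [Nat.cast_mul, cast_prod _ hk, cast_prod _ le_rfl, ← gaussBinomNat_mul_prod] at hz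
  have hne : ∏ i ∈ range k, ((Fintype.card F : ℤ) ^ k - (Fintype.card F : ℤ) ^ i) ≠ 0 := by
    refine prod_ne_zero_iff.mpr fun i hi => sub_ne_zero.mpr fun e => ?_
    have := Nat.pow_right_injective hq (by exact_mod_cast e : Fintype.card F ^ k = _)
    simp at hi
    omega
  rw [Nat.card_eq_fintype_card]
  exact_mod_cast (mul_right_cancel₀ hne hz).symm

lemma natCard_submodule_ge (L : Submodule F V) (b : ℕ) :
    (Nat.card {B : Submodule F V // finrank F B = b ∧ L ≤ B} : ℤ) =
      gaussBinom (Fintype.card F) (finrank F V - finrank F L) (b - finrank F L) := by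
  by_cases hb : finrank F L ≤ b
  swap
  · rw [gaussBinom, if_neg (by omega), Nat.cast_eq_zero, Nat.card_eq_zero]
    exact Or.inl ⟨fun B => hb (B.2.1 ▸ Submodule.finrank_mono B.2.2)⟩
  have : Finite (V ⧸ L) := Finite.of_surjective _ L.mkQ_surjective
  have hL := Submodule.finrank_le L
  have hQ := Submodule.finrank_quotient_add_finrank L
  have hdim (W : Submodule F (V ⧸ L)) :
      finrank F (W.comap L.mkQ) = finrank F W + finrank F L := by
    have e := Submodule.finrank_quotient_add_finrank (W.comap L.mkQ)
    have e' := Submodule.finrank_quotient_add_finrank W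
    have := (Submodule.quotientQuotientEquivQuotient L (W.comap L.mkQ)
      (by simpa using Submodule.le_comap_mkQ L W)).finrank_eq
    rw [Submodule.map_comap_eq_of_surjective L.mkQ_surjective] at this
    omega
  have e : {B : Submodule F V // finrank F B = b ∧ L ≤ B} ≃
      {W : Submodule F (V ⧸ L) // finrank F W = b - finrank F L} :=
    { toFun := fun B => ⟨B.1.map L.mkQ, by
        have := hdim (B.1.map L.mkQ)
        rw [Submodule.comap_map_mkQ, sup_eq_right.mpr B.2.2, B.2.1] at this
        omega⟩
      invFun := fun W => ⟨W.1.comap L.mkQ, by rw [hdim, W.2]; omega, Submodule.le_comap_mkQ L W.1⟩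
      left_inv := fun B => Subtype.ext (by simpa using B.2.2)
      right_inv := fun W => Subtype.ext
        (Submodule.map_comap_eq_of_surjective L.mkQ_surjective W.1) }
  rw [Nat.card_congr e, natCard_submodule_finrank_eq, ← gaussBinom_natCast]
  congr 1 <;> omega

lemma natCard_submodule_Icc {L T : Submodule F V} (hLT : L ≤ T) (b : ℕ) :
    (Nat.card {B : Submodule F V // finrank F B = b ∧ L ≤ B ∧ B ≤ T} : ℤ) =
      gaussBinom (Fintype.card F) (finrank F T - finrank F L) (b - finrank F L) := by
  have hdim {B : Submodule F V} (hB : B ≤ T) : finrank F (B.comap T.subtype) = finrank F B :=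
    (Submodule.comapSubtypeEquivOfLe hB).finrank_eq
  have e : {B : Submodule F V // finrank F B = b ∧ L ≤ B ∧ B ≤ T} ≃
      {W : Submodule F T // finrank F W = b ∧ L.comap T.subtype ≤ W} :=
    { toFun := fun B => ⟨B.1.comap T.subtype, by rw [hdim B.2.2.2, B.2.1],
        Submodule.comap_mono B.2.2.1⟩
      invFun := fun W => ⟨W.1.map T.subtype, by
        rw [Submodule.finrank_map_subtype_eq, W.2.1], by
        have := Submodule.map_mono (f := T.subtype) W.2.2
        rwa [Submodule.map_comap_subtype, inf_eq_right.mpr hLT] at this,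
        Submodule.map_subtype_le T W.1⟩
      left_inv := fun B => Subtype.ext (by simpa using B.2.2.2)
      right_inv := fun W => Subtype.ext
        (Submodule.comap_map_eq_of_injective T.injective_subtype W.1) }
  rw [Nat.card_congr e, natCard_submodule_ge, hdim hLT]

open Classical in
lemma card_filter_submodule_Icc [Fintype (Submodule F V)] {L T : Submodule F V} (hLT : L ≤ T)
    (b : ℕ) :
    (∑ B : Submodule F V, if finrank F B = b ∧ L ≤ B ∧ B ≤ T then (1 : ℤ) else 0) =
      gaussBinom (Fintype.card F) (finrank F T - finrank F L) (b - finrank F L) := by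
  rw [← natCard_submodule_Icc hLT, sum_boole, Nat.card_eq_fintype_card, Fintype.card_subtype]

open Classical in
/-- Double counting of the triples `L ≤ B ≤ U ⊓ S` of subspaces of dimensions `l`, `b`, `k`. -/
lemma sum_gaussBinom_finrank_inf [Fintype (Submodule F V)] (S : Submodule F V) (k l b : ℕ) :
    (∑ U : Submodule F V, if finrank F U = k then
      gaussBinom (Fintype.card F) (finrank F ↥(U ⊓ S)) l *
        gaussBinom (Fintype.card F) (finrank F ↥(U ⊓ S) - l) (b - l) else 0) =
      gaussBinom (Fintype.card F) (finrank F S) l *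
        gaussBinom (Fintype.card F) (finrank F S - l) (b - l) *
        gaussBinom (Fintype.card F) (finrank F V - b) (k - b) := by
  have flags (T : Submodule F V) : gaussBinom (Fintype.card F) (finrank F T) l *
      gaussBinom (Fintype.card F) (finrank F T - l) (b - l) =
      ∑ L : Submodule F V, ∑ B : Submodule F V,
        if finrank F L = l ∧ finrank F B = b ∧ L ≤ B ∧ B ≤ T then (1 : ℤ) else 0 := by
    have h := card_filter_submodule_Icc (bot_le : ⊥ ≤ T) l
    simp only [finrank_bot, Nat.cast_zero, sub_zero, bot_le, true_and] at h
    rw [← h, sum_mul]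
    refine sum_congr rfl fun L _ => ?_
    by_cases hL : finrank F L = l ∧ L ≤ T
    · rw [if_pos hL, one_mul, ← hL.1, ← card_filter_submodule_Icc hL.2]
      exact sum_congr rfl fun B _ => by simp
    · rw [if_neg hL, zero_mul]
      exact (sum_eq_zero fun B _ => if_neg fun hB => hL ⟨hB.1, hB.2.2.1.trans hB.2.2.2⟩).symm
  have hover {B : Submodule F V} (hB : finrank F B = b) :
      gaussBinom (Fintype.card F) (finrank F V - b) (k - b) =
        ∑ U : Submodule F V, if finrank F U = k ∧ B ≤ U then (1 : ℤ) else 0 := by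
    have h := card_filter_submodule_Icc (le_top : B ≤ ⊤) k
    simp only [finrank_top, le_top, and_true, hB] at h
    exact h.symm
  simp only [flags, sum_mul]
  calc _ = ∑ U : Submodule F V, ∑ L : Submodule F V, ∑ B : Submodule F V,
        if finrank F U = k ∧ finrank F L = l ∧ finrank F B = b ∧ L ≤ B ∧ B ≤ U ⊓ S
        then (1 : ℤ) else 0 := sum_congr rfl fun U _ => by
          by_cases hU : finrank F U = k <;> simp [hU]
    _ = _ := by
      rw [sum_comm]
      refine sum_congr rfl fun L _ => ?_
      rw [sum_comm]
      refine sum_congr rfl fun B _ => ?_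
      by_cases hB : finrank F L = l ∧ finrank F B = b ∧ L ≤ B ∧ B ≤ S
      · rw [if_pos hB, one_mul, hover hB.2.1]
        exact sum_congr rfl fun U _ => by simp [hB]
      · rw [if_neg hB, zero_mul]
        exact sum_eq_zero fun U _ => if_neg fun h =>
          hB ⟨h.2.1, h.2.2.1, h.2.2.2.1, h.2.2.2.2.trans inf_le_right⟩

end Counting

lemma sum_Icc_gaussBinom_alternating (q : ℕ) {d m l : ℕ} (hd : d ≤ m) (hl : l ≤ m) :
    ∑ b ∈ Icc l m, gaussBinom q d l * gaussBinom q ((d : ℤ) - l) ((b : ℤ) - l) *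
      (-1) ^ (b - l) * (q : ℤ) ^ ((b - l) * (b - l - 1) / 2) = if d = l then 1 else 0 := by
  by_cases hdl : l ≤ d
  swap
  · rw [gaussBinom_natCast, gaussBinomNat_eq_zero_of_lt q (by omega), if_neg (by omega)]
    simp
  have h := sum_neg_one_pow_mul_gaussBinomNat q (by omega : d - l < m + 1 - l)
  rw [← Finset.Ico_add_one_right_eq_Icc, sum_Ico_eq_sum_range]
  have e : ∀ j ∈ range (m + 1 - l), gaussBinom q d l *
      gaussBinom q ((d : ℤ) - l) (((l + j : ℕ) : ℤ) - l) * (-1) ^ (l + j - l) *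
      (q : ℤ) ^ ((l + j - l) * (l + j - l - 1) / 2) = gaussBinom q d l *
      ((gaussBinomNat q (d - l) j : ℤ) * (-1) ^ j * (q : ℤ) ^ (j * (j - 1) / 2)) := fun j _ => by
    rw [← gaussBinom_natCast, Nat.add_sub_cancel_left, Nat.cast_sub hdl]
    push_cast
    rw [add_sub_cancel_left]
    ring
  rw [sum_congr rfl e, ← mul_sum, h]
  have hs : ∀ n, gaussBinomNat q n n = 1 := fun n => by
    induction n with
    | zero => rfl
    | succ n ih => rw [gaussBinomNat, ih, gaussBinomNat_eq_zero_of_lt q (Nat.lt_succ_self n)]; simp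
  by_cases hd' : d = l
  · simp [hd', gaussBinom_natCast, hs]
  · rw [if_neg (by omega), if_neg hd', mul_zero]

open Classical in
/-- `∂_q(N,k,m,h)` counts the `k`-dimensional subspaces meeting a given `m`-dimensional
subspace in dimension greater than `h`. -/
lemma partialDelta_eq_sum {F V : Type*} [Field F] [Fintype F] [AddCommGroup V] [Module F V]
    [Finite V] [Fintype (Submodule F V)] (S : Submodule F V) (k h : ℕ) :
    partialDelta (Fintype.card F) (finrank F V) k (finrank F S) h =
      ∑ U : Submodule F V, if finrank F U = k ∧ h < finrank F ↥(U ⊓ S) then 1 else 0 := by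
  have hterm (l b : ℕ) : gaussBinom (Fintype.card F) (finrank F S) l *
      gaussBinom (Fintype.card F) (finrank F S - l) (b - l) *
      gaussBinom (Fintype.card F) (finrank F V - b) (k - b) * (-1) ^ (b - l) *
      (Fintype.card F : ℤ) ^ ((b - l) * (b - l - 1) / 2) =
      ∑ U : Submodule F V, if finrank F U = k then
        gaussBinom (Fintype.card F) (finrank F ↥(U ⊓ S)) l *
        gaussBinom (Fintype.card F) (finrank F ↥(U ⊓ S) - l) (b - l) * (-1) ^ (b - l) *
      (Fintype.card F : ℤ) ^ ((b - l) * (b - l - 1) / 2) else 0 := by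
    rw [← sum_gaussBinom_finrank_inf, sum_mul, sum_mul]
    exact sum_congr rfl fun U _ => by split_ifs <;> simp
  unfold partialDelta
  simp only [hterm]
  rw [sum_congr rfl fun l _ => sum_comm, sum_comm]
  refine sum_congr rfl fun U _ => ?_
  by_cases hU : finrank F U = k
  swap
  · simp [hU]
  have hd : finrank F ↥(U ⊓ S) ≤ finrank F S := Submodule.finrank_mono inf_le_right
  simp only [hU, if_true, true_and]
  rw [sum_congr rfl fun l hl => sum_Icc_gaussBinom_alternating _ hd (mem_Icc.mp hl).2,
    sum_ite_eq]
  exact if_congr (by rw [mem_Icc]; omega) rfl rfl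

end

/-- For a partial `m`-spread `A` of `F_q^N` and `1 ≤ h ≤ m-1`, the
number of `k`-dimensional `(A,h)`-scattered subspaces of `F_q^N` is at least
`[N choose k]_q − |A|·∂_q(N,k,m,h)`. -/
theorem stmt_11 (q N k m h : ℕ) (hq : IsPrimePow q)
    (hk1 : 1 ≤ k) (hkN : k ≤ N) (hm1 : 1 ≤ m) (hm : m ≤ N - k)
    (hh1 : 1 ≤ h) (hhm : h ≤ m - 1)
    (F : Type) [Field F] [Fintype F] (hF : Fintype.card F = q)
    (A : Set (Submodule F (Fin N → F)))
    (hAdim : ∀ S ∈ A, Module.finrank F S = m)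
    (hAint : ∀ S ∈ A, ∀ T ∈ A, S ≠ T → S ⊓ T = ⊥) :
    gaussBinom q N k - (Set.ncard A : ℤ) * partialDelta q N k m h ≤
      (Nat.card {U : Submodule F (Fin N → F) //
        Module.finrank F U = k ∧ ∀ S ∈ A, Module.finrank F ↥(U ⊓ S) ≤ h} : ℤ) := by
  classical
  have := Fintype.ofFinite (Submodule F (Fin N → F))
  subst hF
  have hA : A.Finite := Set.toFinite A
  have hall : gaussBinom (Fintype.card F) N k =
      ∑ U : Submodule F (Fin N → F), if Module.finrank F U = k then (1 : ℤ) else 0 := by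
    rw [Finset.sum_boole, ← Fintype.card_subtype, gaussBinom_natCast]
    have := natCard_submodule_finrank_eq (F := F) (V := Fin N → F) k
    rw [Nat.card_eq_fintype_card, Module.finrank_fin_fun] at this
    rw [this]
  have hbad : (Set.ncard A : ℤ) * partialDelta (Fintype.card F) N k m h =
      ∑ U : Submodule F (Fin N → F), ∑ S ∈ hA.toFinset,
        if Module.finrank F U = k ∧ h < Module.finrank F ↥(U ⊓ S) then (1 : ℤ) else 0 := by
    rw [Finset.sum_comm, Set.ncard_eq_toFinset_card A hA, ← nsmul_eq_mul]
    refine (Finset.sum_eq_card_nsmul fun S hS => ?_).symm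
    rw [← partialDelta_eq_sum, hAdim S (hA.mem_toFinset.mp hS), Module.finrank_fin_fun]
  have hgood : (Nat.card {U : Submodule F (Fin N → F) //
      Module.finrank F U = k ∧ ∀ S ∈ A, Module.finrank F ↥(U ⊓ S) ≤ h} : ℤ) =
      ∑ U : Submodule F (Fin N → F), if Module.finrank F U = k ∧
        ∀ S ∈ A, Module.finrank F ↥(U ⊓ S) ≤ h then (1 : ℤ) else 0 := by
    rw [Finset.sum_boole, ← Fintype.card_subtype, Nat.card_eq_fintype_card]
  rw [hall, hbad, hgood, sub_le_iff_le_add, ← Finset.sum_add_distrib]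
  refine Finset.sum_le_sum fun U _ => ?_
  have hnn : ∀ S ∈ hA.toFinset,
      (0 : ℤ) ≤ if Module.finrank F U = k ∧ h < Module.finrank F ↥(U ⊓ S) then 1 else 0 :=
    fun S _ => by split_ifs <;> simp
  by_cases hU : Module.finrank F U = k
  swap
  · simp [hU]
  by_cases hs : ∀ S ∈ A, Module.finrank F ↥(U ⊓ S) ≤ h
  · rw [if_pos hU, if_pos ⟨hU, hs⟩]
    exact le_add_of_nonneg_right (Finset.sum_nonneg hnn)
  · rw [if_pos hU, if_neg fun h' => hs h'.2, zero_add]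
    push Not at hs
    obtain ⟨S, hSA, hS⟩ := hs
    refine le_trans ?_ (Finset.single_le_sum hnn (hA.mem_toFinset.mpr hSA))
    rw [if_pos ⟨hU, hS⟩]
end

section
/- Let q be a prime power, let m, m' be positive integers, set N = m+m', and let h, k be integers with 0 ≤ h and h+1 ≤ k ≤ m. Let S_∞ be a fixed m'-dimensional F_q-subspace of F_q^N, and let A be a partial m-spread of F_q^N each of whose members intersects S_∞ trivially. If |A| · [m choose h+1]_q · [m−h−1 choose k−h−1]_q < q^{m'(h+1)} · [m choose k]_q, then there exists a k-dimensional (A,h)-scattered F_q-subspace U of F_q^N with U ∩ S_∞ = {0}. -/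
open Module

theorem gaussBinomNat_self_and_eq_zero (q a : ℕ) :
    gaussBinomNat q a a = 1 ∧ ∀ j, gaussBinomNat q a (a + j + 1) = 0 := by
  induction a with
  | zero => simp [gaussBinomNat]
  | succ a ih =>
    refine ⟨by simpa [gaussBinomNat, ih.1] using Or.inr (ih.2 0), fun j => ?_⟩
    rw [show a + 1 + j + 1 = (a + j + 1) + 1 by ring, gaussBinomNat, ih.2 j,
      show a + j + 1 + 1 = a + (j + 1) + 1 by ring, ih.2 (j + 1)]
    simp

/-- The Pascal recursion for Gaussian binomials dual to the defining one. -/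
theorem gaussBinomNat_succ_succ' (q d b : ℕ) :
    gaussBinomNat q (b + d + 1) (b + 1) =
      gaussBinomNat q (b + d) (b + 1) + q ^ d * gaussBinomNat q (b + d) b := by
  induction hn : b + d generalizing b d with
  | zero =>
    obtain ⟨rfl, rfl⟩ : b = 0 ∧ d = 0 := by omega
    simp [gaussBinomNat]
  | succ n ih =>
    cases b with
    | zero =>
      obtain rfl : d = n + 1 := by omega
      have h := ih n 0 (by omega)
      have e₁ : ∀ a, gaussBinomNat q (a + 1) 1 = 1 + q * gaussBinomNat q a 1 := fun a => by
        rw [gaussBinomNat]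
        simp [gaussBinomNat]
      have e₂ : ∀ a, gaussBinomNat q a 0 = 1 := fun a => by simp [gaussBinomNat]
      simp only [e₂, zero_add] at h ⊢
      linear_combination q * h + e₁ (n + 1) + (e₁ n).symm
    | succ c =>
      have h₁ := ih d c (by omega)
      cases d with
      | zero =>
        obtain rfl : c = n := by omega
        have e₁ := (gaussBinomNat_self_and_eq_zero q (c + 1)).2 0
        rw [gaussBinomNat]
        simp only [add_zero] at e₁
        simp [e₁]
      | succ d =>
        have h₂ := ih d (c + 1) (by omega)
        have e₁ : gaussBinomNat q (n + 1) (c + 1 + 1) =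
          gaussBinomNat q n (c + 1) + q ^ (c + 1 + 1) * gaussBinomNat q n (c + 1 + 1) := rfl
        have e₂ : gaussBinomNat q (n + 1) (c + 1) =
          gaussBinomNat q n c + q ^ (c + 1) * gaussBinomNat q n (c + 1) := rfl
        rw [gaussBinomNat]
        linear_combination h₁ + q ^ (c + 2) * h₂ + e₁.symm + q ^ (d + 1) * e₂.symm

/-- The `q`-factorial `[n]_q!`. -/
def qFactorial (q n : ℕ) : ℕ := ∏ i ∈ Finset.range n, ∑ j ∈ Finset.range (i + 1), q ^ j

theorem qFactorial_succ (q n : ℕ) :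
    qFactorial q (n + 1) = qFactorial q n * ∑ j ∈ Finset.range (n + 1), q ^ j :=
  Finset.prod_range_succ _ _

theorem qFactorial_pos (q n : ℕ) : 0 < qFactorial q n :=
  Finset.prod_pos fun i _ => by
    rw [Finset.sum_range_succ']
    simp

theorem gaussBinomNat_mul_qFactorial (q a b : ℕ) :
    gaussBinomNat q (a + b) a * (qFactorial q a * qFactorial q b) = qFactorial q (a + b) := by
  induction hn : a + b generalizing a b with
  | zero =>
    obtain ⟨rfl, rfl⟩ : a = 0 ∧ b = 0 := by omega
    simp [gaussBinomNat, qFactorial]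
  | succ n ih =>
    rcases a with _ | a
    · obtain rfl : b = n + 1 := by omega
      simp [gaussBinomNat, qFactorial]
    rcases b with _ | b
    · obtain rfl : a = n := by omega
      simp [(gaussBinomNat_self_and_eq_zero q (a + 1)).1, qFactorial]
    have h₁ := ih a (b + 1) (by omega)
    have h₂ := ih (a + 1) b (by omega)
    have hs : ∑ j ∈ Finset.range (n + 1), q ^ j =
        ∑ j ∈ Finset.range (a + 1), q ^ j + q ^ (a + 1) * ∑ j ∈ Finset.range (b + 1), q ^ j := by
      rw [show n + 1 = (a + 1) + (b + 1) by omega, Finset.sum_range_add, Finset.mul_sum]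
      simp only [pow_add]
    rw [gaussBinomNat, qFactorial_succ q n, hs]
    have e₁ := qFactorial_succ q a
    have e₂ := qFactorial_succ q b
    calc _ = (gaussBinomNat q n a * (qFactorial q a * qFactorial q (b + 1))) *
            (∑ j ∈ Finset.range (a + 1), q ^ j) +
          q ^ (a + 1) * (gaussBinomNat q n (a + 1) * (qFactorial q (a + 1) * qFactorial q b)) *
            (∑ j ∈ Finset.range (b + 1), q ^ j) := by rw [e₁, e₂]; ring
      _ = _ := by rw [h₁, h₂]; ring

theorem gaussBinomNat_mul_gaussBinomNat (q a b c : ℕ) :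
    gaussBinomNat q (a + b + c) a * gaussBinomNat q (b + c) b =
      gaussBinomNat q (a + b + c) (a + b) * gaussBinomNat q (a + b) a := by
  have h₁ := gaussBinomNat_mul_qFactorial q a (b + c)
  have h₂ := gaussBinomNat_mul_qFactorial q b c
  have h₃ := gaussBinomNat_mul_qFactorial q (a + b) c
  have h₄ := gaussBinomNat_mul_qFactorial q a b
  rw [← add_assoc] at h₁
  have hpos : 0 < qFactorial q a * qFactorial q b * qFactorial q c :=
    mul_pos (mul_pos (qFactorial_pos q a) (qFactorial_pos q b)) (qFactorial_pos q c)
  refine Nat.eq_of_mul_eq_mul_right hpos ?_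
  calc _ = gaussBinomNat q (a + b + c) a * (qFactorial q a *
        (gaussBinomNat q (b + c) b * (qFactorial q b * qFactorial q c))) := by ring
    _ = gaussBinomNat q (a + b + c) (a + b) *
        ((gaussBinomNat q (a + b) a * (qFactorial q a * qFactorial q b)) * qFactorial q c) := by
      rw [h₂, h₁, h₄, h₃]
    _ = _ := by ring

open Classical in
/-- The families of `k` vectors whose space of linear relations has dimension at least `b`. -/
noncomputable def dependentFamilies (F E : Type*) [Field F] [AddCommGroup E] [Module F E]
    [Fintype E] (k b : ℕ) : Finset (Fin k → E) :=
  Finset.univ.filter fun v => finrank F (Submodule.span F (Set.range v)) + b ≤ k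

theorem mem_dependentFamilies {F E : Type*} [Field F] [AddCommGroup E] [Module F E]
    [Fintype E] {k b : ℕ} {v : Fin k → E} :
    v ∈ dependentFamilies F E k b ↔ finrank F (Submodule.span F (Set.range v)) + b ≤ k := by
  simp [dependentFamilies]

section Counting

variable {F E : Type*} [Field F] [Fintype F] [AddCommGroup E] [Module F E] [Fintype E]

theorem card_dependentFamilies_succ_le (k b : ℕ) :
    (dependentFamilies F E (k + 1) (b + 1)).card ≤
      Fintype.card E * (dependentFamilies F E k (b + 1)).card +
        Fintype.card F ^ (k - b) * (dependentFamilies F E k b).card := by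
  classical
  let X : Finset ((_ : Fin k → E) × E) :=
    (dependentFamilies F E k (b + 1)).sigma fun _ => Finset.univ
  let Y : Finset ((_ : Fin k → E) × E) := (dependentFamilies F E k b).sigma fun v =>
    Finset.univ.filter (· ∈ Submodule.span F (Set.range v))
  have hX : X.card = Fintype.card E * (dependentFamilies F E k (b + 1)).card := by
    simp [X, Finset.card_sigma, mul_comm]
  have hY : Y.card ≤ Fintype.card F ^ (k - b) * (dependentFamilies F E k b).card := by
    rw [Finset.card_sigma, mul_comm, ← smul_eq_mul]
    refine Finset.sum_le_card_nsmul _ _ _ fun v hv => ?_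
    rw [mem_dependentFamilies] at hv
    rw [← Fintype.card_subtype, ← Nat.card_eq_fintype_card]
    change Nat.card (Submodule.span F (Set.range v)) ≤ _
    rw [Module.natCard_eq_pow_finrank (K := F), Nat.card_eq_fintype_card]
    exact Nat.pow_le_pow_right Fintype.card_pos (by omega)
  have hsub : dependentFamilies F E (k + 1) (b + 1) ⊆
      (X ∪ Y).image fun p => (Fin.cons p.2 p.1 : Fin (k + 1) → E) := by
    intro v hv
    rw [mem_dependentFamilies] at hv
    refine Finset.mem_image.2 ⟨⟨Fin.tail v, v 0⟩, ?_, Fin.cons_self_tail v⟩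
    have hle : Submodule.span F (Set.range (Fin.tail v)) ≤ Submodule.span F (Set.range v) :=
      Submodule.span_mono (Set.range_comp_subset_range Fin.succ v)
    have hr := Submodule.finrank_mono hle
    by_cases hb : finrank F (Submodule.span F (Set.range (Fin.tail v))) + (b + 1) ≤ k
    · exact Finset.mem_union_left _ (by simp [X, mem_dependentFamilies, hb])
    · refine Finset.mem_union_right _ ?_
      have heq := Submodule.eq_of_le_of_finrank_le hle (by omega)
      simp only [Y, Finset.mem_sigma, mem_dependentFamilies, Finset.mem_filter, Finset.mem_univ,
        true_and]
      exact ⟨by omega, heq ▸ Submodule.subset_span ⟨0, rfl⟩⟩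
  calc _ ≤ _ := Finset.card_le_card hsub
    _ ≤ _ := Finset.card_image_le
    _ ≤ _ := Finset.card_union_le _ _
    _ ≤ _ := by omega

theorem card_dependentFamilies_mul_le (k b : ℕ) :
    (dependentFamilies F E k b).card * Fintype.card E ^ b ≤
      gaussBinomNat (Fintype.card F) k b * Fintype.card E ^ k := by
  classical
  induction k generalizing b with
  | zero =>
    cases b with
    | zero => simpa [gaussBinomNat] using Finset.card_le_univ (dependentFamilies F E 0 0)
    | succ b => simp [gaussBinomNat, dependentFamilies]
  | succ k ih =>
    cases b with
    | zero => simpa [gaussBinomNat] using Finset.card_le_univ (dependentFamilies F E (k + 1) 0)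
    | succ b =>
      by_cases hbk : b ≤ k
      · obtain ⟨d, rfl⟩ := Nat.exists_eq_add_of_le hbk
        have h₀ := card_dependentFamilies_succ_le (F := F) (E := E) (b + d) b
        rw [Nat.add_sub_cancel_left] at h₀
        have h₁ := Nat.mul_le_mul_left (Fintype.card E) (ih (b + 1))
        have h₂ := Nat.mul_le_mul_left (Fintype.card F ^ d * Fintype.card E) (ih b)
        rw [gaussBinomNat_succ_succ']
        calc _ ≤ _ := Nat.mul_le_mul_right _ h₀
          _ = _ := by ring
          _ ≤ _ := Nat.add_le_add h₁ h₂
          _ = _ := by ring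
      · have : dependentFamilies F E (k + 1) (b + 1) = ∅ := by
          ext v
          simp only [mem_dependentFamilies, Finset.notMem_empty, iff_false]
          omega
        simp [this]

/-- If few families are given, some family has a sum of large rank with each of them. -/
theorem exists_forall_add_notMem_dependentFamilies {ι : Type*} (A : Finset ι) {k b : ℕ}
    (p : ι → Fin k → E)
    (h : A.card * gaussBinomNat (Fintype.card F) k b < Fintype.card E ^ b) :
    ∃ v : Fin k → E, ∀ S ∈ A, v + p S ∉ dependentFamilies F E k b := by
  classical
  have hE : 0 < Fintype.card E := Fintype.card_pos
  let B := A.biUnion fun S => (dependentFamilies F E k b).image (· - p S)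
  have hB : B.card ≤ A.card * (dependentFamilies F E k b).card :=
    Finset.card_biUnion_le_card_mul _ _ _ fun _ _ => Finset.card_image_le
  have hlt : B.card < (Finset.univ : Finset (Fin k → E)).card := by
    refine lt_of_mul_lt_mul_right (a := Fintype.card E ^ b) ?_ (Nat.zero_le _)
    calc _ ≤ _ := Nat.mul_le_mul_right _ hB
      _ = A.card * ((dependentFamilies F E k b).card * Fintype.card E ^ b) := by ring
      _ ≤ _ := Nat.mul_le_mul_left _ (card_dependentFamilies_mul_le k b)
      _ = (A.card * gaussBinomNat (Fintype.card F) k b) * Fintype.card E ^ k := by ring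
      _ < Fintype.card E ^ b * Fintype.card E ^ k :=
        Nat.mul_lt_mul_of_pos_right h (pow_pos hE k)
      _ = _ := by simp [mul_comm]
  obtain ⟨v, -, hv⟩ := Finset.exists_mem_notMem_of_card_lt_card hlt
  exact ⟨v, fun S hS hmem =>
    hv (Finset.mem_biUnion.2 ⟨S, hS, Finset.mem_image.2 ⟨_, hmem, by simp⟩⟩)⟩

end Counting

section Geometry

variable {F V : Type*} [Field F] [AddCommGroup V] [Module F V] {k : ℕ}

theorem linearIndependent_and_span_inf_ker_eq_bot {W : Type*} [AddCommGroup W] [Module F W]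
    (π : V →ₗ[F] W) {u : Fin k → V} (hu : LinearIndependent F (π ∘ u)) :
    LinearIndependent F u ∧ Submodule.span F (Set.range u) ⊓ LinearMap.ker π = ⊥ := by
  have hu' := LinearIndependent.of_comp π hu
  refine ⟨hu', ?_⟩
  rw [eq_bot_iff]
  rintro x ⟨hx, hxπ⟩
  obtain ⟨c, rfl⟩ := (Submodule.mem_span_range_iff_exists_fun F).1 hx
  have h0 : ∑ i, c i • (π ∘ u) i = 0 := by simpa using hxπ
  have hc := Fintype.linearIndependent_iff.1 hu c h0
  simp [hc]

/-- Rank-nullity for the restriction of a linear map to the span of an independent family. -/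
theorem finrank_span_inf_ker_add {W : Type*} [AddCommGroup W] [Module F W]
    (p : V →ₗ[F] W) {u : Fin k → V} (hu : LinearIndependent F u) :
    finrank F ↥(Submodule.span F (Set.range u) ⊓ LinearMap.ker p) +
      finrank F (Submodule.span F (Set.range (p ∘ u))) = k := by
  let U := Submodule.span F (Set.range u)
  have : FiniteDimensional F U := FiniteDimensional.span_of_finite F (Set.finite_range u)
  have h := LinearMap.finrank_range_add_finrank_ker (p.domRestrict U)
  have hU : finrank F U = k := by simpa using finrank_span_eq_card hu
  have hrange : LinearMap.range (p.domRestrict U) = Submodule.span F (Set.range (p ∘ u)) := by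
    rw [LinearMap.range_domRestrict, Submodule.map_span, ← Set.range_comp]
  have hker : (LinearMap.ker (p.domRestrict U)).map U.subtype = U ⊓ LinearMap.ker p := by
    rw [LinearMap.ker_domRestrict, Submodule.map_comap_subtype]
  rw [hU, hrange, ← Submodule.finrank_map_subtype_eq, hker] at h
  rw [add_comm]
  exact h

end Geometry

/-- Let `A` be a partial `m`-spread of `F_q^(m+m')` all of whose
members meet a fixed `m'`-dimensional subspace `S_∞` trivially, and let
`h+1 ≤ k ≤ m`. If `|A|·[m choose h+1]_q·[m−h−1 choose k−h−1]_q < q^(m'(h+1))·[m choose k]_q`,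
then there exists a `k`-dimensional `(A,h)`-scattered subspace meeting `S_∞` trivially. -/
theorem stmt_15 (q m m' h k : ℕ) (hq : IsPrimePow q) (hm : 0 < m) (hm' : 0 < m')
    (hhk : h + 1 ≤ k) (hkm : k ≤ m)
    (F : Type) [Field F] [Fintype F] (hF : Fintype.card F = q)
    (Sinf : Submodule F (Fin (m + m') → F)) (hSinf : Module.finrank F Sinf = m')
    (A : Set (Submodule F (Fin (m + m') → F)))
    (hAdim : ∀ S ∈ A, Module.finrank F S = m)
    (hAint : ∀ S ∈ A, ∀ T ∈ A, S ≠ T → S ⊓ T = ⊥)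
    (hAS : ∀ S ∈ A, S ⊓ Sinf = ⊥)
    (hcard : Set.ncard A * gaussBinomNat q m (h + 1) *
        gaussBinomNat q (m - h - 1) (k - h - 1) <
      q ^ (m' * (h + 1)) * gaussBinomNat q m k) :
    ∃ U : Submodule F (Fin (m + m') → F), Module.finrank F U = k ∧
      U ⊓ Sinf = ⊥ ∧ ∀ S ∈ A, Module.finrank F ↥(U ⊓ S) ≤ h := by
  classical
  subst hF
  have hG : 0 < gaussBinomNat (Fintype.card F) m k := by
    by_contra hG
    simp [Nat.eq_zero_of_not_pos hG] at hcard
  have hA : A.Finite := Set.toFinite A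
  have hcard' : hA.toFinset.card * gaussBinomNat (Fintype.card F) k (h + 1) <
      Fintype.card Sinf ^ (h + 1) := by
    obtain ⟨b, rfl⟩ := Nat.exists_eq_add_of_le hhk
    obtain ⟨c, rfl⟩ := Nat.exists_eq_add_of_le hkm
    rw [Set.ncard_eq_toFinset_card A hA, show h + 1 + b + c - h - 1 = b + c by omega,
      show h + 1 + b - h - 1 = b by omega, mul_assoc, gaussBinomNat_mul_gaussBinomNat] at hcard
    rw [Module.card_eq_pow_finrank (K := F) (V := Sinf), hSinf, ← pow_mul]
    refine lt_of_mul_lt_mul_right (lt_of_eq_of_lt ?_ hcard) (Nat.zero_le _)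
    ring
  obtain ⟨C, hC⟩ := Submodule.exists_isCompl Sinf
  have hCm : finrank F C = m := by
    have := Submodule.finrank_add_eq_of_isCompl hC
    simp [hSinf] at this
    omega
  obtain ⟨e, he⟩ : ∃ e : Fin k → C, LinearIndependent F e :=
    ⟨_, (finBasisOfFinrankEq F C hCm).linearIndependent.comp (Fin.castLE hkm)
      (Fin.castLE_injective hkm)⟩
  have hcompl : ∀ S ∈ A, IsCompl Sinf S := fun S hS => by
    have hd : Disjoint Sinf S := (disjoint_iff.2 (hAS S hS)).symm
    refine (Submodule.isCompl_iff_disjoint _ _ ?_).2 hd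
    simp [hSinf, hAdim S hS, add_comm]
  let p : Submodule F (Fin (m + m') → F) → Fin k → Sinf := fun S i =>
    if hS : S ∈ A then Submodule.projectionOnto _ _ (hcompl S hS) (e i) else 0
  obtain ⟨v, hv⟩ := exists_forall_add_notMem_dependentFamilies hA.toFinset p hcard'
  let u : Fin k → Fin (m + m') → F := fun i => v i + e i
  have hπu : Submodule.projectionOnto _ _ hC.symm ∘ u = e := by
    ext1 i
    simp [u, Submodule.projectionOnto_apply_left]
  obtain ⟨hu, hinf⟩ := linearIndependent_and_span_inf_ker_eq_bot
    (Submodule.projectionOnto _ _ hC.symm) (u := u) (by rwa [hπu])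
  refine ⟨Submodule.span F (Set.range u), by simpa using finrank_span_eq_card hu,
    by simpa using hinf, fun S hS => ?_⟩
  have hvS := hv S (hA.mem_toFinset.2 hS)
  have hpu : Submodule.projectionOnto _ _ (hcompl S hS) ∘ u = v + p S := by
    ext1 i
    simp [u, p, hS]
  have hrank := finrank_span_inf_ker_add (Submodule.projectionOnto _ _ (hcompl S hS)) hu
  rw [hpu, Submodule.ker_projectionOnto] at hrank
  rw [mem_dependentFamilies] at hvS
  omega
end
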